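/- Let F be a finite family of strong Pouna sets satisfying constraints (C1), (C2) and (C3). If A, B, C ∈ F, A ≺ B and A ≺ C with B ≠ C, then B ≺ C or C ≺ B. -/

import Mathlib

open Set

noncomputable def lS (S : Set (ℝ × ℝ)) : ℝ := sInf (Prod.fst '' S)
noncomputable def rS (S : Set (ℝ × ℝ)) : ℝ := sSup (Prod.fst '' S)
noncomputable def bS (S : Set (ℝ × ℝ)) : ℝ := sInf (Prod.snd '' S)
noncomputable def tS (S : Set (ℝ × ℝ)) : ℝ := sSup (Prod.snd '' S)

/-- The bounding box of a bounded set in the plane. -/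
noncomputable def boxS (S : Set (ℝ × ℝ)) : Set (ℝ × ℝ) :=
  Icc (lS S) (rS S) ×ˢ Icc (bS S) (tS S)

/-- A Pouna set: nonempty, compact, path-connected, not an axis-parallel rectangle. -/
def Pouna (S : Set (ℝ × ℝ)) : Prop :=
  S.Nonempty ∧ IsCompact S ∧ IsPathConnected S ∧
    ¬ ∃ a b c d : ℝ, S = Icc a b ×ˢ Icc c d

/-- The territory of a set. -/
def Ter (S : Set (ℝ × ℝ)) : Set (ℝ × ℝ) :=
  {p | p ∈ boxS S \ S ∧ ∃ x' > p.1, (x', p.2) ∈ S}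

/-- A strong Pouna set: a Pouna set with nonempty territory. -/
def Strong (S : Set (ℝ × ℝ)) : Prop := Pouna S ∧ (Ter S).Nonempty

/-- `Prec A B` (`A ≺ B`): the bounding box of `A` is inside the territory of `B`. -/
def Prec (A B : Set (ℝ × ℝ)) : Prop := boxS A ⊆ Ter B

/-- `Adj A B` (`A ↷ B`). -/
def Adj (A B : Set (ℝ × ℝ)) : Prop :=
  A ≠ B ∧ (A ∩ B).Nonempty ∧
  lS B ≤ lS A ∧ lS A < rS B ∧ rS B < rS A ∧
  bS B < bS A ∧ bS A < tS A ∧ tS A < tS B ∧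
  {p : ℝ × ℝ | p ∈ A ∧ p.1 = lS A} ⊆ Ter B

def ConstraintC1 (F : Set (Set (ℝ × ℝ))) : Prop :=
  ∀ A ∈ F, ∀ B ∈ F, A ≠ B → (A ∩ B).Nonempty → Adj A B ∨ Adj B A

def ConstraintC2 (F : Set (Set (ℝ × ℝ))) : Prop :=
  ∀ A ∈ F, ∀ B ∈ F, A ∩ B = ∅ → (A ∩ Ter B).Nonempty → Prec A B

def ConstraintC3 (F : Set (Set (ℝ × ℝ))) : Prop :=
  ∀ A ∈ F, ∀ B ∈ F, A ≠ B → (A ∩ B).Nonempty → ¬ ∃ C ∈ F, C ⊆ Ter A ∩ Ter B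

def ConstraintC4 (F : Set (Set (ℝ × ℝ))) : Prop :=
  ¬ ∃ A ∈ F, ∃ B ∈ F, ∃ C ∈ F, Prec A B ∧ Adj A C ∧ Adj B C

def ConstraintC5 (F : Set (Set (ℝ × ℝ))) : Prop :=
  ¬ ∃ A ∈ F, ∃ B ∈ F, ∃ C ∈ F, A ≠ B ∧ A ≠ C ∧ B ≠ C ∧
    (A ∩ B).Nonempty ∧ (A ∩ C).Nonempty ∧ (B ∩ C).Nonempty

theorem fst_le_rS {S : Set (ℝ × ℝ)} (hS : IsCompact S) {p : ℝ × ℝ} (hp : p ∈ S) :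
    p.1 ≤ rS S :=
  le_csSup (hS.image continuous_fst).bddAbove (mem_image_of_mem _ hp)

theorem subset_boxS {S : Set (ℝ × ℝ)} (hS : IsCompact S) : S ⊆ boxS S := fun _ hp =>
  ⟨⟨csInf_le (hS.image continuous_fst).bddBelow (mem_image_of_mem _ hp), fst_le_rS hS hp⟩,
    csInf_le (hS.image continuous_snd).bddBelow (mem_image_of_mem _ hp),
    le_csSup (hS.image continuous_snd).bddAbove (mem_image_of_mem _ hp)⟩

/-- Moving right from a point of the territory of `S`, one stays in the territory of `S`
until the last point of `S` on that horizontal line, except at points of `S`. -/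
theorem mem_Ter_of_lt {S : Set (ℝ × ℝ)} (hS : IsCompact S) {p : ℝ × ℝ} (hp : p ∈ Ter S)
    {x x' : ℝ} (hpx : p.1 < x) (hxx' : x < x') (hx' : (x', p.2) ∈ S) (hx : (x, p.2) ∉ S) :
    (x, p.2) ∈ Ter S :=
  ⟨⟨⟨⟨hp.1.1.1.1.trans hpx.le, hxx'.le.trans (fst_le_rS hS hx')⟩, hp.1.1.2⟩, hx⟩,
    x', hxx', hx'⟩

/-- Axiom (A1) for a finite family of strong Pouna sets satisfying (C1), (C2), (C3). -/
theorem stmt_6 (F : Set (Set (ℝ × ℝ))) (hfin : F.Finite)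
    (hstrong : ∀ S ∈ F, Strong S)
    (h1 : ConstraintC1 F) (h2 : ConstraintC2 F) (h3 : ConstraintC3 F)
    (A B C : Set (ℝ × ℝ)) (hA : A ∈ F) (hB : B ∈ F) (hC : C ∈ F)
    (hAB : Prec A B) (hAC : Prec A C) (hBC : B ≠ C) :
    Prec B C ∨ Prec C B := by
  have hdisj : B ∩ C = ∅ := by
    by_contra hne
    have hbox := subset_boxS (hstrong A hA).1.2.1
    exact h3 B hB C hC hBC (nonempty_iff_ne_empty.2 hne)
      ⟨A, hA, subset_inter (hbox.trans hAB) (hbox.trans hAC)⟩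
  have hd : Disjoint B C := disjoint_iff_inter_eq_empty.2 hdisj
  have hcB := (hstrong B hB).1.2.1
  have hcC := (hstrong C hC).1.2.1
  obtain ⟨p, hp⟩ := (hstrong A hA).1.1
  have hpA := subset_boxS (hstrong A hA).1.2.1 hp
  obtain ⟨x, hpx, hx⟩ := (hAB hpA).2
  obtain ⟨x', hpx', hx'⟩ := (hAC hpA).2
  rcases lt_trichotomy x x' with h | rfl | h
  · exact .inl (h2 B hB C hC hdisj
      ⟨_, hx, mem_Ter_of_lt hcC (hAC hpA) hpx h hx' (hd.notMem_of_mem_left hx)⟩)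
  · exact absurd hx' (hd.notMem_of_mem_left hx)
  · exact .inr (h2 C hC B hB (by rwa [inter_comm])
      ⟨_, hx', mem_Ter_of_lt hcB (hAB hpA) hpx' h hx (hd.notMem_of_mem_right hx')⟩)
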